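/- Let f : ℝ^{d₁} × ℝ^{d₂} → ℝ be continuously differentiable with ∇_α f and ∇_β f locally Lipschitz, and let g : ℝ^{d₁} × ℝ^{d₂} → ℝ be twice continuously differentiable such that ∇_β g is locally Lipschitz, there is m > 0 such that g(α, ·) is m-strongly convex on ℝ^{d₂} for every α, and the mixed second derivative D_α∇_β g(α, β) is bounded in operator norm uniformly in (α, β). Let β*(α) denote the unique global minimiser of g(α, ·), set F(α) := f(α, β*(α)), and let ∇̄f denote the surrogate gradient. Let γ₁, γ₂ : [0,∞) → (0,∞) be nonincreasing continuous with lim_{t→∞} γ₁(t) = lim_{t→∞} γ₂(t) = lim_{t→∞} γ₁(t)/γ₂(t) = 0 and ∫₀^∞ γ₁(t) dt = ∫₀^∞ γ₂(t) dt = ∞. Let α : [0,∞) → ℝ^{d₁}, β : [0,∞) → ℝ^{d₂} be continuous with sup_{t≥0}(‖α(t)‖ + ‖β(t)‖) < ∞ and satisfy α(t) = α(0) − ∫₀^t γ₁(u) ∇̄f(α(u), β(u)) du − E₁(t) and β(t) = β(0) − ∫₀^t γ₂(u) ∇_β g(α(u), β(u)) du − E₂(t), where E₁, E₂ are continuous noise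 paths converging to finite limits as t → ∞. Assume finally that the image F({α ∈ ℝ^{d₁} : ∇F(α) = 0}) has empty interior in ℝ. Then lim_{t→∞} ∇F(α(t)) = 0 and lim_{t→∞} ∇_β g(α(t), β(t)) = 0; the second limit implies lim_{t→∞} ‖β(t) − β*(α(t))‖ = 0. -/

import Mathlib

open Filter

/-- The gradient of `f` in its first variable: `∇_α f(α, β)`. -/
noncomputable def gradFst {d₁ d₂ : ℕ}
    (f : EuclideanSpace ℝ (Fin d₁) × EuclideanSpace ℝ (Fin d₂) → ℝ)
    (α : EuclideanSpace ℝ (Fin d₁)) (β : EuclideanSpace ℝ (Fin d₂)) :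
    EuclideanSpace ℝ (Fin d₁) :=
  gradient (fun a => f (a, β)) α

/-- The gradient of `g` in its second variable: `∇_β g(α, β)`. -/
noncomputable def gradSnd {d₁ d₂ : ℕ}
    (g : EuclideanSpace ℝ (Fin d₁) × EuclideanSpace ℝ (Fin d₂) → ℝ)
    (α : EuclideanSpace ℝ (Fin d₁)) (β : EuclideanSpace ℝ (Fin d₂)) :
    EuclideanSpace ℝ (Fin d₂) :=
  gradient (fun b => g (α, b)) β

/-- The surrogate gradient `∇̄f(α, β)` of `f` relative to `g`:
`∇̄f(α, β) = ∇_α f(α, β) − (D_α ∇_β g(α, β))* [∇²_{ββ} g(α, β)]⁻¹ ∇_β f(α, β)`,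
where `Hinv α β` is the inverse of the partial Hessian `∇²_{ββ} g(α, β)`. -/
noncomputable def surrogateGrad {d₁ d₂ : ℕ}
    (f g : EuclideanSpace ℝ (Fin d₁) × EuclideanSpace ℝ (Fin d₂) → ℝ)
    (Hinv : EuclideanSpace ℝ (Fin d₁) → EuclideanSpace ℝ (Fin d₂) →
      (EuclideanSpace ℝ (Fin d₂) ≃L[ℝ] EuclideanSpace ℝ (Fin d₂)))
    (α : EuclideanSpace ℝ (Fin d₁)) (β : EuclideanSpace ℝ (Fin d₂)) :
    EuclideanSpace ℝ (Fin d₁) :=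
  gradFst f α β -
    (ContinuousLinearMap.adjoint (fderiv ℝ (fun a => gradSnd g a β) α))
      ((Hinv α β).symm (gradSnd f α β))

open Topology Set Asymptotics

section Comparison

theorem le_of_hasDerivAt_neg_of_eq {φ φ' : ℝ → ℝ} {c t₀ : ℝ}
    (hφ : ∀ t ≥ t₀, HasDerivAt φ (φ' t) t) (hneg : ∀ t ≥ t₀, φ t = c → φ' t < 0)
    (h₀ : φ t₀ ≤ c) : ∀ t ≥ t₀, φ t ≤ c := by
  intro t ht
  exact image_le_of_deriv_right_lt_deriv_boundary (a := t₀) (b := t)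
    (fun x hx => (hφ x hx.1).continuousAt.continuousWithinAt)
    (fun x hx => (hφ x hx.1).hasDerivWithinAt) (B := fun _ => c) (B' := fun _ => 0) h₀
    (fun x => hasDerivAt_const x c) (fun x hx => hneg x hx.1) ⟨ht, le_rfl⟩

theorem add_mul_le_add_mul_of_hasDerivAt_le {φ φ' Γ γ : ℝ → ℝ} {k s t : ℝ} (hst : s ≤ t)
    (hφ : ∀ u ∈ Icc s t, HasDerivAt φ (φ' u) u) (hΓ : ∀ u ∈ Icc s t, HasDerivAt Γ (γ u) u)
    (hle : ∀ u ∈ Icc s t, φ' u ≤ -k * γ u) : φ t + k * Γ t ≤ φ s + k * Γ s := by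
  have hd : ∀ u ∈ Icc s t, HasDerivAt (fun u => φ u + k * Γ u) (φ' u + k * γ u) u :=
    fun u hu => (hφ u hu).add ((hΓ u hu).const_mul k)
  refine antitoneOn_of_deriv_nonpos (convex_Icc s t)
    (fun u hu => (hd u hu).continuousAt.continuousWithinAt)
    (fun u hu => (hd u (interior_subset hu)).differentiableAt.differentiableWithinAt)
    (fun u hu => ?_) ⟨le_rfl, hst⟩ ⟨hst, le_rfl⟩ hst
  rw [(hd u (interior_subset hu)).deriv]
  linarith [hle u (interior_subset hu)]

theorem eventually_le_of_hasDerivAt_le {φ φ' Γ γ : ℝ → ℝ} {c k T : ℝ} (hk : 0 < k)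
    (hφ0 : ∀ t, 0 ≤ φ t) (hφ : ∀ t ≥ T, HasDerivAt φ (φ' t) t)
    (hΓ : ∀ t ≥ T, HasDerivAt Γ (γ t) t) (hγ : ∀ t ≥ T, 0 < γ t) (hΓlim : Tendsto Γ atTop atTop)
    (hle : ∀ t ≥ T, c ≤ φ t → φ' t ≤ -k * γ t) : ∀ᶠ t in atTop, φ t ≤ c := by
  obtain ⟨t₀, ht₀, h₀⟩ : ∃ t₀ ≥ T, φ t₀ ≤ c := by
    by_contra! hcon
    obtain ⟨t, ht, hbig⟩ := ((eventually_ge_atTop T).and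
      (hΓlim.eventually_gt_atTop ((φ T + k * Γ T) / k))).exists
    have := add_mul_le_add_mul_of_hasDerivAt_le (k := k) ht (fun u hu => hφ u hu.1)
      (fun u hu => hΓ u hu.1) (fun u hu => hle u hu.1 (hcon u hu.1).le)
    rw [div_lt_iff₀ hk] at hbig
    linarith [hφ0 t]
  filter_upwards [eventually_ge_atTop t₀] with t ht
  refine le_of_hasDerivAt_neg_of_eq (fun t ht => hφ t (ht₀.trans ht)) (fun t ht h => ?_) h₀ t ht
  have := hle t (ht₀.trans ht) h.ge
  nlinarith [hγ t (ht₀.trans ht), mul_pos hk (hγ t (ht₀.trans ht))]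

theorem norm_sub_le_of_hasDerivAt {E : Type*} [NormedAddCommGroup E] [NormedSpace ℝ E]
    {a a' : ℝ → E} {Γ γ : ℝ → ℝ} {C s t : ℝ} (hst : s ≤ t)
    (ha : ∀ u ∈ Icc s t, HasDerivAt a (a' u) u) (hΓ : ∀ u ∈ Icc s t, HasDerivAt Γ (γ u) u)
    (hle : ∀ u ∈ Icc s t, ‖a' u‖ ≤ C * γ u) : ‖a t - a s‖ ≤ C * (Γ t - Γ s) := by
  refine image_norm_le_of_norm_deriv_right_le_deriv_boundary' (a := s) (b := t)
    (f := fun u => a u - a s) (f' := a') (B := fun u => C * (Γ u - Γ s)) (B' := fun u => C * γ u)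
    (fun u hu => ((ha u hu).sub_const _).continuousAt.continuousWithinAt)
    (fun u hu => ((ha u (Ico_subset_Icc_self hu)).sub_const _).hasDerivWithinAt)
    (by simp)
    (fun u hu => (((hΓ u hu).sub_const _).const_mul C).continuousAt.continuousWithinAt)
    (fun u hu => (((hΓ u (Ico_subset_Icc_self hu)).sub_const _).const_mul C).hasDerivWithinAt)
    (fun u hu => hle u (Ico_subset_Icc_self hu)) ⟨hst, le_rfl⟩

theorem hasDerivAt_integral_of_continuousOn_Ici {E : Type*} [NormedAddCommGroup E]
    [NormedSpace ℝ E] [CompleteSpace E] {c : ℝ → E} (hc : ContinuousOn c (Ici 0)) {t : ℝ}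
    (ht : 0 < t) : HasDerivAt (fun s => ∫ u in (0 : ℝ)..s, c u) (c t) t := by
  refine intervalIntegral.integral_hasDerivAt_right ?_
    ((hc.mono Ioi_subset_Ici_self).stronglyMeasurableAtFilter isOpen_Ioi t ht)
    (hc.continuousAt (Ici_mem_nhds ht))
  refine (hc.mono ?_).intervalIntegrable
  rw [uIcc_of_le ht.le]
  exact Icc_subset_Ici_self

theorem tendsto_comp_sub_comp {X Y : Type*} [SeminormedAddCommGroup X] [ProperSpace X]
    [SeminormedAddCommGroup Y] {Ψ : X → Y} (hΨ : Continuous Ψ) {p q : ℝ → X} {R : ℝ}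
    (hp : ∀ᶠ t in atTop, ‖p t‖ ≤ R) (hpq : Tendsto (fun t => p t - q t) atTop (𝓝 0)) :
    Tendsto (fun t => Ψ (p t) - Ψ (q t)) atTop (𝓝 0) := by
  have huc := (isCompact_closedBall (0 : X) (R + 1)).uniformContinuousOn_of_continuous
    hΨ.continuousOn
  rw [Metric.uniformContinuousOn_iff] at huc
  rw [Metric.tendsto_nhds] at hpq ⊢
  intro ε hε
  obtain ⟨δ, hδ, h⟩ := huc ε hε
  filter_upwards [hp, hpq δ hδ, hpq 1 one_pos] with t h1 h2 h3
  rw [dist_zero_right, ← dist_eq_norm] at *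
  refine h _ (by rw [mem_closedBall_zero_iff]; linarith) _ ?_ h2
  rw [mem_closedBall_zero_iff]
  rw [dist_eq_norm] at h3
  have := norm_sub_norm_le (q t) (p t)
  rw [norm_sub_rev] at this
  linarith

end Comparison

section GradientFlow

variable {E : Type*} [NormedAddCommGroup E] [InnerProductSpace ℝ E]

/-- A path following a perturbed gradient flow of `F`, in the time scale `Γ`, makes the gradient
of `F` vanish asymptotically if the critical values of `F` have empty interior. -/
theorem tendsto_gradient_of_perturbed_flow [ProperSpace E] {F : E → ℝ}
    {F' : E → E} (hF : ∀ x, HasGradientAt F (F' x) x) (hF' : Continuous F')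
    (hcrit : interior (F '' {x | F' x = 0}) = ∅)
    {a S : ℝ → E} {Γ γ : ℝ → ℝ} {R : ℝ}
    (hγ : ∀ t > 0, 0 < γ t) (hΓ : ∀ t > 0, HasDerivAt Γ (γ t) t) (hΓlim : Tendsto Γ atTop atTop)
    (ha : ∀ t > 0, HasDerivAt a (-(γ t • S t)) t) (hR : ∀ᶠ t in atTop, ‖a t‖ ≤ R)
    (hS : Tendsto (fun t => S t - F' (a t)) atTop (𝓝 0)) :
    Tendsto (fun t => F' (a t)) atTop (𝓝 0) := by
  have hFc : Continuous F := continuous_iff_continuousAt.2 fun x => (hF x).hasFDerivAt.continuousAt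
  set K := Metric.closedBall (0 : E) R
  have hK : IsCompact K := isCompact_closedBall _ _
  have haK : ∀ᶠ t in atTop, a t ∈ K := hR.mono fun t ht => mem_closedBall_zero_iff.2 ht
  set φ : ℝ → ℝ := fun t => F (a t)
  set φ' : ℝ → ℝ := fun t => -(γ t * inner ℝ (F' (a t)) (S t))
  have hφ : ∀ t > 0, HasDerivAt φ (φ' t) t := fun t ht => by
    refine ((hF (a t)).hasFDerivAt.comp_hasDerivAt t (ha t ht)).congr_deriv ?_
    simp [φ', inner_smul_right]
  have hdecr : ∀ η > 0, ∀ᶠ t in atTop, η ≤ ‖F' (a t)‖ → φ' t ≤ -(η ^ 2 / 2) * γ t := by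
    intro η hη
    have hS' := (tendsto_zero_iff_norm_tendsto_zero.1 hS).eventually_lt_const (half_pos hη)
    filter_upwards [hS', eventually_gt_atTop 0] with t h1 h2 h3
    have h4 : inner ℝ (F' (a t)) (S t) =
        ‖F' (a t)‖ ^ 2 + inner ℝ (F' (a t)) (S t - F' (a t)) := by
      rw [inner_sub_right, real_inner_self_eq_norm_sq]; ring
    have h5 := neg_le_of_abs_le (abs_real_inner_le_norm (F' (a t)) (S t - F' (a t)))
    have h6 : η ^ 2 / 2 ≤ inner ℝ (F' (a t)) (S t) := by
      rw [h4]
      nlinarith [norm_nonneg (F' (a t)), norm_nonneg (S t - F' (a t))]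
    simp only [φ']
    nlinarith [hγ t h2]
  -- The values of `F` along the path converge.
  obtain ⟨l, hl⟩ : ∃ l, Tendsto φ atTop (𝓝 l) := by
    have hcompact : IsCompact (F '' K) := hK.image hFc
    have hφK : ∀ᶠ t in atTop, φ t ∈ F '' K := haK.mono fun t ht => mem_image_of_mem F ht
    refine tendsto_of_no_upcrossings (interior_eq_empty_iff_dense_compl.1 hcrit) ?_ ?_ ?_
    · rintro c hc d - hcd ⟨hfr₁, hfr₂⟩
      have hLc : IsCompact (K ∩ F ⁻¹' {c}) :=
        hK.inter_right (isClosed_singleton.preimage hFc)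
      obtain ⟨η, hη, hηL⟩ : ∃ η > 0, ∀ x ∈ K ∩ F ⁻¹' {c}, η ≤ ‖F' x‖ := by
        rcases (K ∩ F ⁻¹' {c}).eq_empty_or_nonempty with he | hne
        · exact ⟨1, one_pos, by simp [he]⟩
        · obtain ⟨x, hx, hxmin⟩ := hLc.exists_isMinOn hne hF'.norm.continuousOn
          refine ⟨‖F' x‖, norm_pos_iff.2 fun h0 => hc ⟨x, h0, hx.2⟩, fun y hy => hxmin hy⟩
      obtain ⟨T, hT⟩ := eventually_atTop.1
        ((hdecr η hη).and (haK.and (eventually_gt_atTop 0)))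
      obtain ⟨t₀, ht₀, h₀⟩ := frequently_atTop.1 hfr₁ T
      obtain ⟨t, ht, h1⟩ := frequently_atTop.1 hfr₂ t₀
      have := le_of_hasDerivAt_neg_of_eq (c := c) (φ := φ) (φ' := φ') (t₀ := t₀)
        (fun t ht => hφ t (hT t (ht₀.trans ht)).2.2) (fun t ht h => ?_) h₀.le t ht
      · linarith
      · obtain ⟨h2, h3, h4⟩ := hT t (ht₀.trans ht)
        have := h2 (hηL _ ⟨h3, h⟩)
        nlinarith [hγ t h4, mul_pos (pow_pos hη 2) (hγ t h4)]
    · obtain ⟨B, hB⟩ := hcompact.bddAbove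
      exact ⟨B, eventually_map.2 (hφK.mono fun t ht => hB ht)⟩
    · obtain ⟨B, hB⟩ := hcompact.bddBelow
      exact ⟨B, eventually_map.2 (hφK.mono fun t ht => hB ht)⟩
  -- Each excursion of the gradient away from zero costs a fixed amount of `F`.
  by_contra hnot
  rw [Metric.tendsto_nhds] at hnot
  push Not at hnot
  obtain ⟨ε, hε, hfr⟩ := hnot
  simp only [dist_zero_right] at hfr
  obtain ⟨C, hC, hF'C⟩ : ∃ C > 0, ∀ x ∈ K, ‖F' x‖ ≤ C := by
    obtain ⟨C, hC⟩ := hK.exists_bound_of_continuousOn hF'.continuousOn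
    exact ⟨max C 1, by positivity, fun x hx => (hC x hx).trans (le_max_left _ _)⟩
  obtain ⟨δ, hδ, huc⟩ := Metric.uniformContinuousOn_iff.1
    (hK.uniformContinuousOn_of_continuous hF'.continuousOn) (ε / 2) (half_pos hε)
  set κ := (ε / 2) ^ 2 / 2 * (δ / (2 * (C + 1)))
  have hκ : 0 < κ := by positivity
  have hS1 := (tendsto_zero_iff_norm_tendsto_zero.1 hS).eventually_lt_const one_pos
  have hlκ := Metric.tendsto_nhds.1 hl (κ / 2) (half_pos hκ)
  obtain ⟨T, hT⟩ := eventually_atTop.1 ((hdecr (ε / 2) (half_pos hε)).and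
    (haK.and ((eventually_gt_atTop 0).and (hS1.and hlκ))))
  obtain ⟨t₀, ht₀, h₀⟩ := frequently_atTop.1 hfr T
  have hΓc : ContinuousOn Γ (Ici t₀) := fun u hu =>
    (hΓ u (hT u (ht₀.trans hu)).2.2.1).continuousAt.continuousWithinAt
  obtain ⟨t₁, ht₁, hΓ₁⟩ : ∃ t₁ ≥ t₀, Γ t₁ = Γ t₀ + δ / (2 * (C + 1)) := by
    obtain ⟨s, hs, hs'⟩ := ((eventually_ge_atTop t₀).and
      (hΓlim.eventually_ge_atTop (Γ t₀ + δ / (2 * (C + 1))))).exists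
    obtain ⟨t₁, h1, h2⟩ := intermediate_value_Icc hs (hΓc.mono Icc_subset_Ici_self)
      ⟨le_add_of_nonneg_right (by positivity), hs'⟩
    exact ⟨t₁, h1.1, h2⟩
  have hpos : ∀ u ∈ Icc t₀ t₁, 0 < u := fun u hu => (hT u (ht₀.trans hu.1)).2.2.1
  have hmono : ∀ u ∈ Icc t₀ t₁, Γ u ≤ Γ t₁ := fun u hu => by
    have := add_mul_le_add_mul_of_hasDerivAt_le (φ := fun _ => 0) (φ' := fun _ => 0) (k := -1)
      hu.2 (fun v _ => hasDerivAt_const v 0) (fun v hv => hΓ v (hpos v ⟨hu.1.trans hv.1, hv.2⟩))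
      (fun v hv => by simpa using (hγ v (hpos v ⟨hu.1.trans hv.1, hv.2⟩)).le)
    linarith
  have hgrad : ∀ u ∈ Icc t₀ t₁, ε / 2 ≤ ‖F' (a u)‖ := by
    intro u hu
    have h1 : ‖a u - a t₀‖ ≤ (C + 1) * (Γ u - Γ t₀) := by
      refine norm_sub_le_of_hasDerivAt hu.1
        (fun v hv => ha v (hpos v ⟨hv.1, hv.2.trans hu.2⟩))
        (fun v hv => hΓ v (hpos v ⟨hv.1, hv.2.trans hu.2⟩)) (fun v hv => ?_)
      have hv0 := hpos v ⟨hv.1, hv.2.trans hu.2⟩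
      obtain ⟨-, h2, -, h3, -⟩ := hT v (ht₀.trans hv.1)
      rw [norm_neg, norm_smul, Real.norm_of_nonneg (hγ v hv0).le, mul_comm]
      refine mul_le_mul_of_nonneg_right ?_ (hγ v hv0).le
      linarith [hF'C _ h2, norm_le_norm_add_norm_sub' (S v) (F' (a v))]
    have h2 : (C + 1) * (Γ u - Γ t₀) ≤ δ / 2 := by
      have := hmono u hu
      calc (C + 1) * (Γ u - Γ t₀) ≤ (C + 1) * (δ / (2 * (C + 1))) := by gcongr; linarith
        _ = δ / 2 := by field_simp
    have h3 := huc (a u) (hT u (ht₀.trans hu.1)).2.1 (a t₀) (hT t₀ ht₀).2.1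
      (by rw [dist_eq_norm]; linarith)
    rw [dist_eq_norm, norm_sub_rev] at h3
    linarith [norm_le_norm_add_norm_sub' (F' (a t₀)) (F' (a u))]
  have hdrop := add_mul_le_add_mul_of_hasDerivAt_le (k := (ε / 2) ^ 2 / 2) ht₁
    (fun u hu => hφ u (hpos u hu)) (fun u hu => hΓ u (hpos u hu))
    (fun u hu => (hT u (ht₀.trans hu.1)).1 (hgrad u hu))
  rw [hΓ₁, mul_add] at hdrop
  change φ t₁ + (_ + κ) ≤ _ at hdrop
  have h1 := (abs_lt.1 (Real.dist_eq _ _ ▸ (hT t₀ ht₀).2.2.2.2)).2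
  have h2 := (abs_lt.1 (Real.dist_eq _ _ ▸ (hT t₁ (ht₀.trans ht₁)).2.2.2.2)).1
  linarith

end GradientFlow

section FastVariable

theorem tendsto_zero_of_inner_deriv_le {E : Type*} [NormedAddCommGroup E]
    [InnerProductSpace ℝ E] {y y' : ℝ → E} {Γ γ r : ℝ → ℝ} {m : ℝ} (hm : 0 < m)
    (hγ : ∀ t > 0, 0 < γ t) (hΓ : ∀ t > 0, HasDerivAt Γ (γ t) t) (hΓlim : Tendsto Γ atTop atTop)
    (hy : ∀ t > 0, HasDerivAt y (y' t) t) (hr : Tendsto r atTop (𝓝 0))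
    (hle : ∀ᶠ t in atTop, inner ℝ (y t) (y' t) ≤ γ t * (‖y t‖ * (r t - m * ‖y t‖))) :
    Tendsto y atTop (𝓝 0) := by
  rw [Metric.tendsto_nhds]
  intro ε hε
  obtain ⟨T, hT⟩ := eventually_atTop.1 (hle.and ((eventually_gt_atTop 0).and
    (hr.eventually_lt_const (show 0 < m * (ε / 4) by positivity))))
  have := eventually_le_of_hasDerivAt_le (φ := fun t => ‖y t‖ ^ 2) (c := (ε / 2) ^ 2)
    (k := m * (ε / 2) ^ 2) (by positivity) (fun t => by positivity)
    (fun t ht => (hy t (hT t ht).2.1).norm_sq) (fun t ht => hΓ t (hT t ht).2.1)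
    (fun t ht => hγ t (hT t ht).2.1) hΓlim (fun t ht h => ?_)
  · filter_upwards [this] with t ht
    rw [dist_zero_right]
    linarith [(sq_le_sq₀ (norm_nonneg (y t)) (half_pos hε).le).1 ht]
  · obtain ⟨h1, h2, h3⟩ := hT t ht
    have h4 := (sq_le_sq₀ (half_pos hε).le (norm_nonneg (y t))).1 h
    have h5 : ‖y t‖ * (r t - m * ‖y t‖) ≤ -(m / 2 * (ε / 2) ^ 2) := by
      have h6 : r t - m * ‖y t‖ ≤ -(m / 2 * ‖y t‖) := by nlinarith
      nlinarith [norm_nonneg (y t)]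
    nlinarith [hγ t h2]

end FastVariable

section StrongConvexity

variable {E : Type*} [NormedAddCommGroup E] [InnerProductSpace ℝ E] [CompleteSpace E]

theorem ConvexOn.inner_gradient_sub_nonneg {h : E → ℝ} {h' : E → E}
    (hc : ConvexOn ℝ univ h) (hd : ∀ x, HasGradientAt h (h' x) x) (x y : E) :
    0 ≤ inner ℝ (h' x - h' y) (x - y) := by
  have hline : ∀ t : ℝ, HasDerivAt (fun t : ℝ => h (AffineMap.lineMap y x t))
      (inner ℝ (h' (AffineMap.lineMap y x t)) (x - y)) t := fun t =>
    ((hd (AffineMap.lineMap y x t)).hasFDerivAt.comp_hasDerivAt t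
      AffineMap.hasDerivAt_lineMap).congr_deriv (by simp)
  have hmono := (hc.comp_affineMap (AffineMap.lineMap y x : ℝ →ᵃ[ℝ] E)).monotoneOn_deriv
    (fun t _ => (hline t).differentiableAt) (mem_univ 0) (mem_univ 1) zero_le_one
  change deriv (fun t : ℝ => h (AffineMap.lineMap y x t)) 0 ≤
    deriv (fun t : ℝ => h (AffineMap.lineMap y x t)) 1 at hmono
  rw [(hline 0).deriv, (hline 1).deriv, AffineMap.lineMap_apply_zero,
    AffineMap.lineMap_apply_one] at hmono
  rw [inner_sub_left]
  linarith

theorem mul_norm_sub_sq_le_inner_gradient_sub {h : E → ℝ} {h' : E → E} {m : ℝ}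
    (hc : ConvexOn ℝ univ fun x => h x - m / 2 * ‖x‖ ^ 2)
    (hd : ∀ x, HasGradientAt h (h' x) x) (x y : E) :
    m * ‖x - y‖ ^ 2 ≤ inner ℝ (h' x - h' y) (x - y) := by
  have key := hc.inner_gradient_sub_nonneg (h' := fun x => h' x - m • x) (fun z => by
    have := (hd z).hasFDerivAt.sub ((hasStrictFDerivAt_norm_sq z).hasFDerivAt.const_mul (m / 2))
    rw [hasGradientAt_iff_hasFDerivAt]
    refine this.congr_fderiv ?_
    ext v
    simp
    ring) x y
  have h1 : h' x - m • x - (h' y - m • y) = h' x - h' y - m • (x - y) := by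
    rw [smul_sub]; abel
  rw [h1, inner_sub_left, inner_smul_left, real_inner_self_eq_norm_sq] at key
  simpa using key

end StrongConvexity

theorem hasFDerivAt_of_implicit_of_lipschitz {E F G : Type*} [NormedAddCommGroup E]
    [NormedSpace ℝ E] [NormedAddCommGroup F] [NormedSpace ℝ F] [NormedAddCommGroup G]
    [NormedSpace ℝ G] {Φ : E × F → G} {b : E → F} {A : E →L[ℝ] G} {H : F ≃L[ℝ] G} {x : E}
    {L : NNReal} (hΦ : HasFDerivAt Φ (A.coprod (H : F →L[ℝ] G)) (x, b x))
    (hzero : ∀ z, Φ (z, b z) = 0) (hb : LipschitzWith L b) :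
    HasFDerivAt b (-((H.symm : G →L[ℝ] F).comp A)) x := by
  have hu : Tendsto (fun z => (z, b z)) (𝓝 x) (𝓝 (x, b x)) :=
    (continuous_id.prodMk hb.continuous).tendsto x
  have hO : (fun z => (z, b z) - (x, b x)) =O[𝓝 x] fun z => z - x := by
    refine IsBigO.prod_left (isBigO_refl _ _) (IsBigO.of_bound L (Eventually.of_forall fun z => ?_))
    simpa [dist_eq_norm] using hb.dist_le_mul z x
  have ho := (hΦ.isLittleO.comp_tendsto hu).trans_isBigO hO
  have ho' := ((H.symm : G →L[ℝ] F).isBigO_comp _ (𝓝 x)).trans_isLittleO ho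
  refine HasFDerivAt.of_isLittleO (ho'.neg_left.congr_left fun z => ?_)
  simp [hzero]
  abel

section PartialGradients

variable {d₁ d₂ : ℕ} {f g : EuclideanSpace ℝ (Fin d₁) × EuclideanSpace ℝ (Fin d₂) → ℝ}

theorem hasGradientAt_gradFst (hf : Differentiable ℝ f) (a : EuclideanSpace ℝ (Fin d₁))
    (b : EuclideanSpace ℝ (Fin d₂)) : HasGradientAt (fun a => f (a, b)) (gradFst f a b) a :=
  (hf.comp (differentiable_id.prodMk (differentiable_const b)) a).hasGradientAt

theorem hasGradientAt_gradSnd (hf : Differentiable ℝ f) (a : EuclideanSpace ℝ (Fin d₁))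
    (b : EuclideanSpace ℝ (Fin d₂)) : HasGradientAt (fun b => f (a, b)) (gradSnd f a b) b :=
  (hf.comp ((differentiable_const a).prodMk differentiable_id) b).hasGradientAt

theorem inner_gradFst (hf : Differentiable ℝ f) (a v : EuclideanSpace ℝ (Fin d₁))
    (b : EuclideanSpace ℝ (Fin d₂)) :
    inner ℝ (gradFst f a b) v = fderiv ℝ f (a, b) (v, 0) := by
  have h := (hf (a, b)).hasFDerivAt.comp (f := fun a => (a, b)) a (hasFDerivAt_prodMk_left a b)
  have := congrArg (fun φ => φ v) ((hasGradientAt_gradFst hf a b).hasFDerivAt.unique h)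
  simpa using this

theorem inner_gradSnd (hf : Differentiable ℝ f) (a : EuclideanSpace ℝ (Fin d₁))
    (b v : EuclideanSpace ℝ (Fin d₂)) :
    inner ℝ (gradSnd f a b) v = fderiv ℝ f (a, b) (0, v) := by
  have h := (hf (a, b)).hasFDerivAt.comp (f := fun b => (a, b)) b (hasFDerivAt_prodMk_right a b)
  have := congrArg (fun φ => φ v) ((hasGradientAt_gradSnd hf a b).hasFDerivAt.unique h)
  simpa using this

theorem contDiff_gradSnd (hg : ContDiff ℝ 2 g) :
    ContDiff ℝ 1 (fun p : EuclideanSpace ℝ (Fin d₁) × EuclideanSpace ℝ (Fin d₂) =>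
      gradSnd g p.1 p.2) := by
  have hd : Differentiable ℝ g := hg.differentiable two_ne_zero
  rw [contDiff_euclidean]
  intro i
  have : ∀ p : EuclideanSpace ℝ (Fin d₁) × EuclideanSpace ℝ (Fin d₂),
      gradSnd g p.1 p.2 i = fderiv ℝ g p (0, EuclideanSpace.single i 1) := fun p => by
    rw [← inner_gradSnd hd, EuclideanSpace.inner_single_right]
    simp
  simp_rw [this]
  exact (hg.fderiv_right (m := 1) (by norm_num)).clm_apply contDiff_const

theorem hasFDerivAt_gradSnd (hg : ContDiff ℝ 2 g) (a : EuclideanSpace ℝ (Fin d₁))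
    (b : EuclideanSpace ℝ (Fin d₂)) :
    HasFDerivAt (fun p : EuclideanSpace ℝ (Fin d₁) × EuclideanSpace ℝ (Fin d₂) =>
      gradSnd g p.1 p.2) ((fderiv ℝ (fun a => gradSnd g a b) a).coprod
        (fderiv ℝ (fun b => gradSnd g a b) b)) (a, b) := by
  have h := ((contDiff_gradSnd hg).differentiable one_ne_zero (a, b)).hasFDerivAt
  have hfst : HasFDerivAt (fun a => gradSnd g a b) _ a :=
    h.comp (f := fun a => (a, b)) a (hasFDerivAt_prodMk_left a b)
  have hsnd : HasFDerivAt (fun b => gradSnd g a b) _ b :=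
    h.comp (f := fun b => (a, b)) b (hasFDerivAt_prodMk_right a b)
  rw [hfst.fderiv, hsnd.fderiv]
  refine h.congr_fderiv ?_
  ext <;> simp

theorem inner_fderiv_gradSnd_comm (hg : ContDiff ℝ 2 g) (a : EuclideanSpace ℝ (Fin d₁))
    (b u v : EuclideanSpace ℝ (Fin d₂)) :
    inner ℝ (fderiv ℝ (fun b => gradSnd g a b) b u) v =
      inner ℝ u (fderiv ℝ (fun b => gradSnd g a b) b v) := by
  have hd : Differentiable ℝ g := hg.differentiable two_ne_zero
  have key : ∀ u v : EuclideanSpace ℝ (Fin d₂),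
      inner ℝ (fderiv ℝ (fun b => gradSnd g a b) b u) v =
        fderiv ℝ (fderiv ℝ g) (a, b) (0, u) (0, v) := fun u v => by
    have h1 : HasFDerivAt (fun b => gradSnd g a b) (fderiv ℝ (fun b => gradSnd g a b) b) b :=
      ((contDiff_gradSnd hg).differentiable one_ne_zero |>.comp
        ((differentiable_const a).prodMk differentiable_id) b).hasFDerivAt
    have h2 := h1.inner ℝ (hasFDerivAt_const v b)
    simp_rw [inner_gradSnd hd] at h2
    have h3 := ((hg.fderiv_right (m := 1) (by norm_num)).differentiable one_ne_zero
      (a, b)).hasFDerivAt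
    have h4 := (h3.comp b (hasFDerivAt_prodMk_right a b)).clm_apply
      (hasFDerivAt_const ((0, v) : EuclideanSpace ℝ (Fin d₁) × EuclideanSpace ℝ (Fin d₂)) b)
    have := congrArg (fun φ => φ u) (h2.unique h4)
    simpa using this
  rw [real_inner_comm _ u, key, key]
  exact hg.contDiffAt.isSymmSndFDerivAt (by simp) _ _

variable {Hinv : EuclideanSpace ℝ (Fin d₁) → EuclideanSpace ℝ (Fin d₂) →
  (EuclideanSpace ℝ (Fin d₂) ≃L[ℝ] EuclideanSpace ℝ (Fin d₂))}

theorem continuous_surrogateGrad (hg : ContDiff ℝ 2 g)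
    (hfα : Continuous fun p : EuclideanSpace ℝ (Fin d₁) × EuclideanSpace ℝ (Fin d₂) =>
      gradFst f p.1 p.2)
    (hfβ : Continuous fun p : EuclideanSpace ℝ (Fin d₁) × EuclideanSpace ℝ (Fin d₂) =>
      gradSnd f p.1 p.2)
    (hHinv : ∀ a b, ((Hinv a b) : EuclideanSpace ℝ (Fin d₂) →L[ℝ] EuclideanSpace ℝ (Fin d₂)) =
      fderiv ℝ (fun b' => gradSnd g a b') b) :
    Continuous fun p : EuclideanSpace ℝ (Fin d₁) × EuclideanSpace ℝ (Fin d₂) =>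
      surrogateGrad f g Hinv p.1 p.2 := by
  have hG := (contDiff_gradSnd hg).continuous_fderiv one_ne_zero
  have hA : Continuous fun p : EuclideanSpace ℝ (Fin d₁) × EuclideanSpace ℝ (Fin d₂) =>
      fderiv ℝ (fun a => gradSnd g a p.2) p.1 := by
    refine (hG.clm_comp (continuous_const (y := ContinuousLinearMap.inl ℝ _ _))).congr fun p => ?_
    rw [(hasFDerivAt_gradSnd hg p.1 p.2).fderiv, ContinuousLinearMap.coprod_comp_inl]
  have hH : Continuous fun p : EuclideanSpace ℝ (Fin d₁) × EuclideanSpace ℝ (Fin d₂) =>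
      ((Hinv p.1 p.2) : EuclideanSpace ℝ (Fin d₂) →L[ℝ] EuclideanSpace ℝ (Fin d₂)) := by
    refine (hG.clm_comp (continuous_const (y := ContinuousLinearMap.inr ℝ _ _))).congr fun p => ?_
    rw [(hasFDerivAt_gradSnd hg p.1 p.2).fderiv, ContinuousLinearMap.coprod_comp_inr, hHinv]
  have hHs : Continuous fun p : EuclideanSpace ℝ (Fin d₁) × EuclideanSpace ℝ (Fin d₂) =>
      ((Hinv p.1 p.2).symm : EuclideanSpace ℝ (Fin d₂) →L[ℝ] EuclideanSpace ℝ (Fin d₂)) := by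
    simp_rw [← ContinuousLinearMap.inverse_equiv]
    exact continuous_iff_continuousAt.2 fun p => ContinuousAt.comp
      (f := fun p : EuclideanSpace ℝ (Fin d₁) × EuclideanSpace ℝ (Fin d₂) =>
        ((Hinv p.1 p.2) : EuclideanSpace ℝ (Fin d₂) →L[ℝ] EuclideanSpace ℝ (Fin d₂)))
      (contDiffAt_map_inverse (n := 0) (Hinv p.1 p.2)).continuousAt hH.continuousAt
  exact hfα.sub ((ContinuousLinearMap.adjoint.continuous.comp hA).clm_apply (hHs.clm_apply hfβ))

/-- Along the graph of the implicit solution of `∇_β g = 0`, the surrogate gradient is the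
gradient of the reduced function. -/
theorem hasGradientAt_surrogateGrad (hf : ContDiff ℝ 1 f) (hg : ContDiff ℝ 2 g)
    {bstar : EuclideanSpace ℝ (Fin d₁) → EuclideanSpace ℝ (Fin d₂)}
    {a : EuclideanSpace ℝ (Fin d₁)}
    (hHinv : ∀ a b, ((Hinv a b) : EuclideanSpace ℝ (Fin d₂) →L[ℝ] EuclideanSpace ℝ (Fin d₂)) =
      fderiv ℝ (fun b' => gradSnd g a b') b)
    (hb : HasFDerivAt bstar (-(((Hinv a (bstar a)).symm :
      EuclideanSpace ℝ (Fin d₂) →L[ℝ] EuclideanSpace ℝ (Fin d₂)).comp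
        (fderiv ℝ (fun a' => gradSnd g a' (bstar a)) a))) a) :
    HasGradientAt (fun a => f (a, bstar a)) (surrogateGrad f g Hinv a (bstar a)) a := by
  have hd : Differentiable ℝ f := hf.differentiable one_ne_zero
  have hsymm : ∀ u v, inner ℝ ((Hinv a (bstar a)).symm u) v =
      inner ℝ u ((Hinv a (bstar a)).symm v) := fun u v => by
    have := inner_fderiv_gradSnd_comm hg a (bstar a) ((Hinv a (bstar a)).symm u)
      ((Hinv a (bstar a)).symm v)
    rw [← hHinv] at this
    simpa using this.symm
  rw [hasGradientAt_iff_hasFDerivAt]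
  refine ((hd (a, bstar a)).hasFDerivAt.comp a ((hasFDerivAt_id a).prodMk hb)).congr_fderiv ?_
  ext v
  have hsplit : ∀ w : EuclideanSpace ℝ (Fin d₂),
      ((v, w) : EuclideanSpace ℝ (Fin d₁) × EuclideanSpace ℝ (Fin d₂)) = (v, 0) + (0, w) := by
    simp
  simp only [ContinuousLinearMap.comp_apply, ContinuousLinearMap.prod_apply,
    ContinuousLinearMap.id_apply, InnerProductSpace.toDual_apply_apply, surrogateGrad,
    inner_sub_left, ContinuousLinearMap.adjoint_inner_left, hsymm]
  rw [hsplit, map_add, ← inner_gradFst hd, ← inner_gradSnd hd]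
  simp [inner_neg_right, sub_eq_add_neg]

end PartialGradients

section Minimiser

variable {d₁ d₂ : ℕ} {g : EuclideanSpace ℝ (Fin d₁) × EuclideanSpace ℝ (Fin d₂) → ℝ}
  {bstar : EuclideanSpace ℝ (Fin d₁) → EuclideanSpace ℝ (Fin d₂)}

theorem gradSnd_eq_zero_of_forall_le {a : EuclideanSpace ℝ (Fin d₁)}
    {b : EuclideanSpace ℝ (Fin d₂)} (hmin : ∀ b', g (a, b) ≤ g (a, b')) : gradSnd g a b = 0 := by
  have h : IsLocalMin (fun b => g (a, b)) b := Eventually.of_forall hmin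
  rw [gradSnd, gradient, h.fderiv_eq_zero, map_zero]

theorem lipschitzWith_of_gradSnd_eq_zero (hg : ContDiff ℝ 2 g) {m : ℝ} (hm : 0 < m)
    (hstrong : ∀ a, ConvexOn ℝ Set.univ
      (fun b : EuclideanSpace ℝ (Fin d₂) => g (a, b) - m / 2 * ‖b‖ ^ 2)) {Cmix : ℝ}
    (hmix : ∀ a b, ‖fderiv ℝ (fun a' => gradSnd g a' b) a‖ ≤ Cmix)
    (hzero : ∀ a, gradSnd g a (bstar a) = 0) :
    LipschitzWith (Cmix / m).toNNReal bstar := by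
  have hC : 0 ≤ Cmix := (norm_nonneg _).trans (hmix 0 0)
  refine LipschitzWith.of_dist_le_mul fun x y => ?_
  rw [Real.coe_toNNReal _ (by positivity), dist_eq_norm, dist_eq_norm, div_mul_eq_mul_div,
    le_div_iff₀ hm]
  have hmono := mul_norm_sub_sq_le_inner_gradient_sub (hstrong x)
    (hasGradientAt_gradSnd (hg.differentiable two_ne_zero) x) (bstar x) (bstar y)
  have hcs := hmono.trans (real_inner_le_norm _ _)
  have hG : ‖gradSnd g x (bstar x) - gradSnd g x (bstar y)‖ ≤ Cmix * ‖x - y‖ := by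
    have hdiff : Differentiable ℝ fun a => gradSnd g a (bstar y) :=
      ((contDiff_gradSnd hg).differentiable one_ne_zero).comp
        (differentiable_id.prodMk (differentiable_const (bstar y)))
    have := convex_univ.norm_image_sub_le_of_norm_fderiv_le (fun a _ => hdiff a)
      (fun a _ => hmix a (bstar y)) (mem_univ y) (mem_univ x)
    rw [hzero, zero_sub, norm_neg]
    simpa only [hzero, sub_zero] using this
  rcases (norm_nonneg (bstar x - bstar y)).eq_or_lt with h0 | h0
  · rw [← h0, zero_mul]; positivity
  · nlinarith

end Minimiser

theorem hasDerivAt_add_noise {E : Type*} [NormedAddCommGroup E] [NormedSpace ℝ E]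
    [CompleteSpace E] {x c e : ℝ → E} (hc : ContinuousOn c (Ici 0))
    (hx : ∀ t ≥ (0 : ℝ), x t = x 0 - (∫ u in (0 : ℝ)..t, c u) - e t) (l : E) {t : ℝ}
    (ht : 0 < t) : HasDerivAt (fun s => x s + (e s - l)) (-c t) t := by
  refine ((hasDerivAt_integral_of_continuousOn_Ici hc ht).const_sub
    (x 0 - l)).congr_of_eventuallyEq ?_
  filter_upwards [Ioi_mem_nhds ht] with s hs
  rw [hx s (le_of_lt hs)]
  abel

theorem stmt12 {d₁ d₂ : ℕ} (hd₁ : 1 ≤ d₁) (hd₂ : 1 ≤ d₂)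
    (f g : EuclideanSpace ℝ (Fin d₁) × EuclideanSpace ℝ (Fin d₂) → ℝ)
    (hf : ContDiff ℝ 1 f) (hg : ContDiff ℝ 2 g)
    (hfαLip : LocallyLipschitz (fun p :
      EuclideanSpace ℝ (Fin d₁) × EuclideanSpace ℝ (Fin d₂) => gradFst f p.1 p.2))
    (hfβLip : LocallyLipschitz (fun p :
      EuclideanSpace ℝ (Fin d₁) × EuclideanSpace ℝ (Fin d₂) => gradSnd f p.1 p.2))
    (hgLip : LocallyLipschitz (fun p :
      EuclideanSpace ℝ (Fin d₁) × EuclideanSpace ℝ (Fin d₂) => gradSnd g p.1 p.2))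
    (m : ℝ) (hm : 0 < m)
    (hstrong : ∀ a, ConvexOn ℝ Set.univ
      (fun b : EuclideanSpace ℝ (Fin d₂) => g (a, b) - m / 2 * ‖b‖ ^ 2))
    (Cmix : ℝ)
    (hmix : ∀ a b, ‖fderiv ℝ (fun a' => gradSnd g a' b) a‖ ≤ Cmix)
    (bstar : EuclideanSpace ℝ (Fin d₁) → EuclideanSpace ℝ (Fin d₂))
    (hmin : ∀ a b, g (a, bstar a) ≤ g (a, b))
    (Hinv : EuclideanSpace ℝ (Fin d₁) → EuclideanSpace ℝ (Fin d₂) →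
      (EuclideanSpace ℝ (Fin d₂) ≃L[ℝ] EuclideanSpace ℝ (Fin d₂)))
    (hHinv : ∀ a b, ((Hinv a b) : EuclideanSpace ℝ (Fin d₂) →L[ℝ] EuclideanSpace ℝ (Fin d₂)) =
      fderiv ℝ (fun b' => gradSnd g a b') b)
    (γ₁ γ₂ : ℝ → ℝ)
    (hγ₁pos : ∀ t ≥ (0:ℝ), 0 < γ₁ t) (hγ₂pos : ∀ t ≥ (0:ℝ), 0 < γ₂ t)
    (hγ₁anti : AntitoneOn γ₁ (Set.Ici (0:ℝ))) (hγ₂anti : AntitoneOn γ₂ (Set.Ici (0:ℝ)))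
    (hγ₁cont : ContinuousOn γ₁ (Set.Ici (0:ℝ))) (hγ₂cont : ContinuousOn γ₂ (Set.Ici (0:ℝ)))
    (hγ₁lim : Tendsto γ₁ atTop (nhds 0)) (hγ₂lim : Tendsto γ₂ atTop (nhds 0))
    (hratio : Tendsto (fun t => γ₁ t / γ₂ t) atTop (nhds 0))
    (hγ₁div : Tendsto (fun t => ∫ u in (0:ℝ)..t, γ₁ u) atTop atTop)
    (hγ₂div : Tendsto (fun t => ∫ u in (0:ℝ)..t, γ₂ u) atTop atTop)
    (α : ℝ → EuclideanSpace ℝ (Fin d₁)) (β : ℝ → EuclideanSpace ℝ (Fin d₂))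
    (hαcont : ContinuousOn α (Set.Ici (0:ℝ))) (hβcont : ContinuousOn β (Set.Ici (0:ℝ)))
    (hbdd : ∃ M : ℝ, ∀ t ≥ (0:ℝ), ‖α t‖ + ‖β t‖ ≤ M)
    (E₁ : ℝ → EuclideanSpace ℝ (Fin d₁)) (E₂ : ℝ → EuclideanSpace ℝ (Fin d₂))
    (hE₁cont : Continuous E₁) (hE₂cont : Continuous E₂)
    (hE₁lim : ∃ l₁, Tendsto E₁ atTop (nhds l₁))
    (hE₂lim : ∃ l₂, Tendsto E₂ atTop (nhds l₂))
    (hαeq : ∀ t ≥ (0:ℝ),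
      α t = α 0 - (∫ u in (0:ℝ)..t, γ₁ u • surrogateGrad f g Hinv (α u) (β u)) - E₁ t)
    (hβeq : ∀ t ≥ (0:ℝ),
      β t = β 0 - (∫ u in (0:ℝ)..t, γ₂ u • gradSnd g (α u) (β u)) - E₂ t)
    (hcrit : interior ((fun a => f (a, bstar a)) ''
      {a | gradient (fun a' => f (a', bstar a')) a = 0}) = (∅ : Set ℝ)) :
    Tendsto (fun t => gradient (fun a => f (a, bstar a)) (α t)) atTop (nhds 0) ∧
    Tendsto (fun t => gradSnd g (α t) (β t)) atTop (nhds 0) ∧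
    Tendsto (fun t => ‖β t - bstar (α t)‖) atTop (nhds 0) := by
  obtain ⟨M, hM⟩ := hbdd
  obtain ⟨l₁, hl₁⟩ := hE₁lim
  obtain ⟨l₂, hl₂⟩ := hE₂lim
  have hgd : Differentiable ℝ g := hg.differentiable two_ne_zero
  have hzero : ∀ a, gradSnd g a (bstar a) = 0 := fun a => gradSnd_eq_zero_of_forall_le (hmin a)
  have hLip := lipschitzWith_of_gradSnd_eq_zero hg hm hstrong hmix hzero
  set L := (Cmix / m).toNNReal
  have hbstar : ∀ a, HasFDerivAt bstar (-(((Hinv a (bstar a)).symm :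
      EuclideanSpace ℝ (Fin d₂) →L[ℝ] EuclideanSpace ℝ (Fin d₂)).comp
        (fderiv ℝ (fun a' => gradSnd g a' (bstar a)) a))) a := fun a =>
    hasFDerivAt_of_implicit_of_lipschitz (hHinv a (bstar a) ▸ hasFDerivAt_gradSnd hg a (bstar a))
      hzero hLip
  have hF : ∀ a, HasGradientAt (fun a => f (a, bstar a)) (surrogateGrad f g Hinv a (bstar a)) a :=
    fun a => hasGradientAt_surrogateGrad hf hg hHinv (hbstar a)
  have hsurr := continuous_surrogateGrad hg hfαLip.continuous hfβLip.continuous hHinv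
  have hG := (contDiff_gradSnd hg).continuous
  have hgraph : Continuous fun a => (a, bstar a) := continuous_id.prodMk hLip.continuous
  have hF'cont : Continuous fun a => surrogateGrad f g Hinv a (bstar a) := hsurr.comp hgraph
  have hgradF : ∀ a, gradient (fun a => f (a, bstar a)) a = surrogateGrad f g Hinv a (bstar a) :=
    fun a => (hF a).gradient
  simp only [hgradF] at hcrit ⊢
  have hpath : ContinuousOn (fun t => (α t, β t)) (Ici 0) := hαcont.prodMk hβcont
  have hpathM : ∀ t ≥ (0 : ℝ), ‖(α t, β t)‖ ≤ M := fun t ht =>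
    max_le (by linarith [hM t ht, norm_nonneg (β t)]) (by linarith [hM t ht, norm_nonneg (α t)])
  -- The noise-corrected paths are differentiable and asymptotic to the original ones.
  set a : ℝ → EuclideanSpace ℝ (Fin d₁) := fun t => α t + (E₁ t - l₁)
  set b : ℝ → EuclideanSpace ℝ (Fin d₂) := fun t => β t + (E₂ t - l₂)
  have ha : ∀ t > 0, HasDerivAt a (-(γ₁ t • surrogateGrad f g Hinv (α t) (β t))) t :=
    fun t ht => hasDerivAt_add_noise (hγ₁cont.smul (hsurr.comp_continuousOn hpath)) hαeq l₁ ht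
  have hb : ∀ t > 0, HasDerivAt b (-(γ₂ t • gradSnd g (α t) (β t))) t :=
    fun t ht => hasDerivAt_add_noise (hγ₂cont.smul (hG.comp_continuousOn hpath)) hβeq l₂ ht
  have hαa : Tendsto (fun t => α t - a t) atTop (𝓝 0) := by
    simpa [a] using (tendsto_const_nhds (x := l₁)).sub hl₁
  have hβb : Tendsto (fun t => β t - b t) atTop (𝓝 0) := by
    simpa [b] using (tendsto_const_nhds (x := l₂)).sub hl₂
  have hαM : ∀ᶠ t in atTop, ‖α t‖ ≤ M := by
    filter_upwards [eventually_ge_atTop 0] with t ht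
    exact (norm_fst_le (α t, β t)).trans (hpathM t ht)
  have haM : ∀ᶠ t in atTop, ‖a t‖ ≤ M + 1 := by
    filter_upwards [hαM, (tendsto_zero_iff_norm_tendsto_zero.1 hαa).eventually_lt_const one_pos]
      with t h1 h2
    rw [norm_sub_rev] at h2
    linarith [norm_le_norm_add_norm_sub' (a t) (α t)]
  have hαβM : ∀ᶠ t in atTop, ‖(α t, β t)‖ ≤ M :=
    (eventually_ge_atTop 0).mono hpathM
  have hΓ₁ : ∀ t > 0, HasDerivAt (fun t => ∫ u in (0 : ℝ)..t, γ₁ u) (γ₁ t) t :=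
    fun t ht => hasDerivAt_integral_of_continuousOn_Ici hγ₁cont ht
  have hΓ₂ : ∀ t > 0, HasDerivAt (fun t => ∫ u in (0 : ℝ)..t, γ₂ u) (γ₂ t) t :=
    fun t ht => hasDerivAt_integral_of_continuousOn_Ici hγ₂cont ht
  obtain ⟨C, hC⟩ : ∃ C, ∀ t ≥ (0 : ℝ), ‖surrogateGrad f g Hinv (α t) (β t)‖ ≤ C := by
    obtain ⟨C, hC⟩ := (isCompact_closedBall (0 : EuclideanSpace ℝ (Fin d₁) ×
      EuclideanSpace ℝ (Fin d₂)) M).exists_bound_of_continuousOn hsurr.continuousOn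
    exact ⟨C, fun t ht => hC (α t, β t) (mem_closedBall_zero_iff.2 (hpathM t ht))⟩
  have hz : Tendsto (fun t => gradSnd g (α t) (β t) - gradSnd g (a t) (b t)) atTop (𝓝 0) :=
    tendsto_comp_sub_comp (p := fun t => (α t, β t)) (q := fun t => (a t, b t)) hG hαβM
      (by simpa only [Prod.mk_sub_mk, Prod.mk_zero_zero] using hαa.prodMk_nhds hβb)
  -- The fast variable tracks the minimiser.
  have hy : Tendsto (fun t => b t - bstar (a t)) atTop (𝓝 0) := by
    refine tendsto_zero_of_inner_deriv_le (m := m)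
      (r := fun t => ‖gradSnd g (α t) (β t) - gradSnd g (a t) (b t)‖ + γ₁ t / γ₂ t * (L * C)) hm
      (fun t ht => hγ₂pos t ht.le) hΓ₂ hγ₂div
      (fun t ht => (hb t ht).sub ((hbstar (a t)).comp_hasDerivAt t (ha t ht)))
      (by simpa using (tendsto_zero_iff_norm_tendsto_zero.1 hz).add (hratio.mul_const (L * C))) ?_
    filter_upwards [eventually_gt_atTop 0] with t ht
    have hD := (hbstar (a t)).le_of_lipschitz hLip
    have hmono := mul_norm_sub_sq_le_inner_gradient_sub (hstrong (a t))
      (hasGradientAt_gradSnd hgd (a t)) (b t) (bstar (a t))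
    rw [hzero, sub_zero, real_inner_comm] at hmono
    generalize -(((Hinv (a t) (bstar (a t))).symm :
      EuclideanSpace ℝ (Fin d₂) →L[ℝ] EuclideanSpace ℝ (Fin d₂)).comp
        (fderiv ℝ (fun a' => gradSnd g a' (bstar (a t))) (a t))) = D at hD ⊢
    set y := b t - bstar (a t)
    set v := gradSnd g (α t) (β t)
    set w := gradSnd g (a t) (b t)
    set s := surrogateGrad f g Hinv (α t) (β t)
    have hyz := neg_le_of_abs_le (abs_real_inner_le_norm y (v - w))
    have hyD : inner ℝ y (D s) ≤ ‖y‖ * (L * C) :=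
      (real_inner_le_norm _ _).trans (mul_le_mul_of_nonneg_left
        ((D.le_opNorm s).trans (mul_le_mul hD (hC t ht.le) (norm_nonneg _) L.2)) (norm_nonneg _))
    have h₁ := hγ₁pos t ht.le
    have h₂ := hγ₂pos t ht.le
    have heq : inner ℝ y (-(γ₂ t • v) - D (-(γ₁ t • s))) =
        -(γ₂ t * (inner ℝ y w + inner ℝ y (v - w))) + γ₁ t * inner ℝ y (D s) := by
      simp only [map_neg, map_smul, inner_sub_right, inner_neg_right, inner_smul_right]
      ring
    have hrhs : γ₂ t * (‖y‖ * (‖v - w‖ + γ₁ t / γ₂ t * (L * C) - m * ‖y‖)) =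
        -(γ₂ t * (m * ‖y‖ ^ 2 + -(‖y‖ * ‖v - w‖))) + γ₁ t * (‖y‖ * (L * C)) := by
      field_simp
      ring
    rw [heq, hrhs]
    gcongr
  have hbstarα : Tendsto (fun t => bstar (α t) - bstar (a t)) atTop (𝓝 0) :=
    tendsto_comp_sub_comp hLip.continuous hαM hαa
  have hβstar : Tendsto (fun t => β t - bstar (α t)) atTop (𝓝 0) := by
    have := (hβb.add hy).sub hbstarα
    simp only [add_zero, sub_zero] at this
    refine this.congr fun t => ?_
    abel
  -- The slow variable follows a perturbed gradient flow of the reduced function.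
  have hS : Tendsto (fun t => surrogateGrad f g Hinv (α t) (β t) -
      surrogateGrad f g Hinv (a t) (bstar (a t))) atTop (𝓝 0) := by
    refine tendsto_comp_sub_comp (p := fun t => (α t, β t)) (q := fun t => (a t, bstar (a t)))
      hsurr hαβM ?_
    have : Tendsto (fun t => β t - bstar (a t)) atTop (𝓝 0) := by simpa using hβb.add hy
    simpa only [Prod.mk_sub_mk, Prod.mk_zero_zero] using hαa.prodMk_nhds this
  have hslow := tendsto_gradient_of_perturbed_flow hF hF'cont hcrit
    (fun t ht => hγ₁pos t ht.le) hΓ₁ hγ₁div ha haM hS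
  refine ⟨?_, ?_, tendsto_zero_iff_norm_tendsto_zero.1 hβstar⟩
  · simpa using (tendsto_comp_sub_comp hF'cont hαM hαa).add hslow
  · have := tendsto_comp_sub_comp (p := fun t => (α t, β t)) (q := fun t => (α t, bstar (α t)))
      hG hαβM (by simpa only [Prod.mk_sub_mk, Prod.mk_zero_zero, sub_self] using
        (tendsto_const_nhds (x := (0 : EuclideanSpace ℝ (Fin d₁)))).prodMk_nhds hβstar)
    simpa [hzero] using this
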